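/- arXiv:2412.14142 — 6 statements merged into one kernel-verified Lean document; each statement's English description precedes it below -/
import Mathlib

section
/- Let H : Δ^Y → ℝ and G : Δ^Y → (Y → ℝ) satisfy the supergradient inequality H(p) ≤ H(q) + Σ_y G(q)(y)·(p(y) − q(y)) for all p, q ∈ Δ^Y, and define the scoring loss ℓ(y,q) := H(q) + G(q)(y) − Σ_{y'} G(q)(y')·q(y'). Then: (i) L(p,q) = H(q) + Σ_y G(q)(y)·(p(y) − q(y)) for all p, q ∈ Δ^Y; (ii) ℓ is proper; (iii) H_ℓ(p) = H(p) for all p ∈ Δ^Y; and (iv) d_ℓ(p,q) = H(q) + Σ_y G(q)(y)·(p(y) − q(y)) − H(p) ≥ 0 for all p, q ∈ Δ^Y. -/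
open Finset
open scoped Classical

noncomputable section

/-- The standard probability simplex over a finite type `Y`. -/
def simplex (Y : Type*) [Fintype Y] : Set (Y → ℝ) :=
  {p | (∀ y, 0 ≤ p y) ∧ ∑ y, p y = 1}

variable {X Y : Type*}

/-- Expected loss `L(p,q) = Σ_y p(y)·ℓ(y,q)`. -/
def expLoss [Fintype Y] (ℓ : Y → (Y → ℝ) → ℝ) (p q : Y → ℝ) : ℝ :=
  ∑ y, p y * ℓ y q

/-- A scoring loss is bounded by `M` if `0 ≤ ℓ(y,q) ≤ M` for all `y` and `q ∈ Δ^Y`. -/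
def IsBoundedLoss [Fintype Y] (ℓ : Y → (Y → ℝ) → ℝ) (M : ℝ) : Prop :=
  ∀ y : Y, ∀ q ∈ simplex Y, 0 ≤ ℓ y q ∧ ℓ y q ≤ M

/-- A scoring loss is proper if `L(p,p) ≤ L(p,q)` for all `p, q ∈ Δ^Y`. -/
def IsProper [Fintype Y] (ℓ : Y → (Y → ℝ) → ℝ) : Prop :=
  ∀ p ∈ simplex Y, ∀ q ∈ simplex Y, expLoss ℓ p p ≤ expLoss ℓ p q

/-- Generalized entropy `H_ℓ(p) = inf_{q ∈ Δ^Y} L(p,q)`. -/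
def genEnt [Fintype Y] (ℓ : Y → (Y → ℝ) → ℝ) (p : Y → ℝ) : ℝ :=
  sInf ((fun q => expLoss ℓ p q) '' simplex Y)

/-- Bregman divergence `d_ℓ(p,q) = L(p,q) − H_ℓ(p)`. -/
def breg [Fintype Y] (ℓ : Y → (Y → ℝ) → ℝ) (p q : Y → ℝ) : ℝ :=
  expLoss ℓ p q - genEnt ℓ p

/-- A probability mass function on `X × Y`. -/
def IsPMF [Fintype X] [Fintype Y] (P : X × Y → ℝ) : Prop :=
  (∀ z, 0 ≤ P z) ∧ ∑ z, P z = 1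

/-- The `X`-marginal `P_X(x) = Σ_y P(x,y)`. -/
def margX [Fintype Y] (P : X × Y → ℝ) (x : X) : ℝ := ∑ y, P (x, y)

/-- The conditional distribution `P(·|x)`. -/
def condY [Fintype Y] (P : X × Y → ℝ) (x : X) : Y → ℝ :=
  fun y => P (x, y) / margX P x

/-- Risk `R_P(h,ℓ) = Σ_{x,y} P(x,y)·ℓ(y,h(x))`. -/
def risk [Fintype X] [Fintype Y] (P : X × Y → ℝ) (h : X → Y → ℝ)
    (ℓ : Y → (Y → ℝ) → ℝ) : ℝ :=
  ∑ z : X × Y, P z * ℓ z.2 (h z.1)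

/-- The weight `w_ν = Σ_{x : h(x)=ν} P_X(x)`. -/
def weight [Fintype X] [Fintype Y] (P : X × Y → ℝ) (h : X → Y → ℝ) (ν : Y → ℝ) : ℝ :=
  ∑ x ∈ univ.filter (fun x => h x = ν), margX P x

/-- The conditional outcome distribution `P(·|h=ν)`. -/
def condOut [Fintype X] [Fintype Y] (P : X × Y → ℝ) (h : X → Y → ℝ) (ν : Y → ℝ) : Y → ℝ :=
  fun y => (∑ x ∈ univ.filter (fun x => h x = ν), P (x, y)) / weight P h ν

/-- `h` is canonically calibrated under `P` if `P(·|h=ν) = ν` whenever `w_ν > 0`. -/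
def Calibrated [Fintype X] [Fintype Y] (P : X × Y → ℝ) (h : X → Y → ℝ) : Prop :=
  ∀ ν : Y → ℝ, 0 < weight P h ν → condOut P h ν = ν

/-- Calibration error `CE_P(h,ℓ) = Σ_{ν : w_ν>0} w_ν · d_ℓ(P(·|h=ν), ν)`,
the sum ranging over the (finitely many) values in the range of `h`. -/
def CE [Fintype X] [Fintype Y] (P : X × Y → ℝ) (h : X → Y → ℝ)
    (ℓ : Y → (Y → ℝ) → ℝ) : ℝ :=
  ∑ ν ∈ (univ.image h).filter (fun ν => 0 < weight P h ν),
    weight P h ν * breg ℓ (condOut P h ν) ν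

/-- Refinement `RF_P(h,ℓ) = Σ_{ν : w_ν>0} w_ν · H_ℓ(P(·|h=ν))`. -/
def RF [Fintype X] [Fintype Y] (P : X × Y → ℝ) (h : X → Y → ℝ)
    (ℓ : Y → (Y → ℝ) → ℝ) : ℝ :=
  ∑ ν ∈ (univ.image h).filter (fun ν => 0 < weight P h ν),
    weight P h ν * genEnt ℓ (condOut P h ν)

/-- Bayes refinement `B_P(ℓ) = Σ_{x : P_X(x)>0} P_X(x) · H_ℓ(P(·|x))`. -/
def BayesRF [Fintype X] [Fintype Y] (P : X × Y → ℝ) (ℓ : Y → (Y → ℝ) → ℝ) : ℝ :=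
  ∑ x ∈ univ.filter (fun x => 0 < margX P x), margX P x * genEnt ℓ (condY P x)

/-- The optimal (Bayes) value `V(Q) = inf_{h : X → Δ^Y} R_Q(h,ℓ)`. -/
def mdlV [Fintype X] [Fintype Y] (ℓ : Y → (Y → ℝ) → ℝ) (Q : X × Y → ℝ) : ℝ :=
  sInf {r : ℝ | ∃ h : X → Y → ℝ, (∀ x, h x ∈ simplex Y) ∧ r = risk Q h ℓ}

/-- a loss built from a supergradient of `H` is proper, its generalized
entropy is `H`, and its Bregman divergence is the (nonnegative) supergradient gap. -/
theorem supergradient_loss_proper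
    [Fintype Y] [Nonempty Y] (H : (Y → ℝ) → ℝ) (G : (Y → ℝ) → Y → ℝ)
    (hsup : ∀ p ∈ simplex Y, ∀ q ∈ simplex Y,
      H p ≤ H q + ∑ y, G q y * (p y - q y))
    (ℓ : Y → (Y → ℝ) → ℝ)
    (hℓ : ∀ y : Y, ∀ q ∈ simplex Y, ℓ y q = H q + G q y - ∑ y', G q y' * q y') :
    (∀ p ∈ simplex Y, ∀ q ∈ simplex Y,
        expLoss ℓ p q = H q + ∑ y, G q y * (p y - q y)) ∧
    IsProper ℓ ∧
    (∀ p ∈ simplex Y, genEnt ℓ p = H p) ∧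
    (∀ p ∈ simplex Y, ∀ q ∈ simplex Y,
        breg ℓ p q = H q + (∑ y, G q y * (p y - q y)) - H p ∧ 0 ≤ breg ℓ p q) := by
  have hL : ∀ p ∈ simplex Y, ∀ q ∈ simplex Y,
      expLoss ℓ p q = H q + ∑ y, G q y * (p y - q y) := by
    intro p hp q hq
    calc expLoss ℓ p q
        = ∑ y, (p y * (H q - ∑ y', G q y' * q y') + G q y * p y) :=
          Finset.sum_congr rfl fun y _ => by rw [hℓ y q hq]; ring
      _ = H q + ∑ y, G q y * (p y - q y) := by
          simp only [Finset.sum_add_distrib, ← Finset.sum_mul, hp.2, mul_sub,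
            Finset.sum_sub_distrib]
          ring
  have hdiag : ∀ p ∈ simplex Y, expLoss ℓ p p = H p := fun p hp => by simp [hL p hp p hp]
  have hle : ∀ p ∈ simplex Y, ∀ q ∈ simplex Y, H p ≤ expLoss ℓ p q :=
    fun p hp q hq => (hsup p hp q hq).trans_eq (hL p hp q hq).symm
  have hent : ∀ p ∈ simplex Y, genEnt ℓ p = H p := fun p hp =>
    IsLeast.csInf_eq ⟨⟨p, hp, hdiag p hp⟩, Set.forall_mem_image.2 (hle p hp)⟩
  refine ⟨hL, fun p hp q hq => (hdiag p hp).trans_le (hle p hp q hq), hent,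
    fun p hp q hq => ⟨?_, ?_⟩⟩
  · rw [breg, hL p hp q hq, hent p hp]
  · rw [breg, hent p hp]
    exact sub_nonneg.2 (hle p hp q hq)

end
end

section
/- Let ℓ be a bounded proper scoring loss. Then for every q ∈ Δ^Y the affine function p ↦ L(p,q) supports H_ℓ at q: L(q,q) = H_ℓ(q) and L(p,q) ≥ H_ℓ(p) for all p ∈ Δ^Y. Consequently, setting G(q)(y) := ℓ(y,q), G is a supergradient of H_ℓ, i.e. H_ℓ(p) ≤ H_ℓ(q) + Σ_y G(q)(y)·(p(y) − q(y)) for all p, q ∈ Δ^Y, and ℓ admits the representation ℓ(y,q) = H_ℓ(q) + G(q)(y) − Σ_{y'} G(q)(y')·q(y') for all y ∈ Y and q ∈ Δ^Y. -/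
open Finset
open scoped Classical

noncomputable section

variable {X Y : Type*}

/-- For a proper loss, the infimum defining `H_ℓ(q)` is attained at `q`. -/
theorem IsProper.expLoss_self_eq_genEnt [Fintype Y] {ℓ : Y → (Y → ℝ) → ℝ} (hp : IsProper ℓ)
    {q : Y → ℝ} (hq : q ∈ simplex Y) : expLoss ℓ q q = genEnt ℓ q := by
  have hleast : IsLeast ((fun r => expLoss ℓ q r) '' simplex Y) (expLoss ℓ q q) :=
    ⟨⟨q, hq, rfl⟩, by rintro _ ⟨r, hr, rfl⟩; exact hp q hq r hr⟩
  exact hleast.csInf_eq.symm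

/-- For a proper loss, the generalized entropy is a lower bound for the expected loss. -/
theorem IsProper.genEnt_le_expLoss [Fintype Y] {ℓ : Y → (Y → ℝ) → ℝ} (hp : IsProper ℓ)
    {p q : Y → ℝ} (hpm : p ∈ simplex Y) (hq : q ∈ simplex Y) : genEnt ℓ p ≤ expLoss ℓ p q :=
  hp.expLoss_self_eq_genEnt hpm ▸ hp p hpm q hq

theorem sum_loss_mul_eq_expLoss [Fintype Y] (ℓ : Y → (Y → ℝ) → ℝ) (p q : Y → ℝ) :
    ∑ y, ℓ y q * p y = expLoss ℓ p q :=
  Finset.sum_congr rfl fun _ _ => mul_comm _ _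

/-- for a bounded proper scoring loss, `p ↦ L(p,q)` supports `H_ℓ` at `q`;
hence `G(q)(y) := ℓ(y,q)` is a supergradient of `H_ℓ` and `ℓ` admits the canonical
representation. -/
theorem proper_loss_representation
    [Fintype Y] [Nonempty Y] (ℓ : Y → (Y → ℝ) → ℝ) (M : ℝ)
    (hb : IsBoundedLoss ℓ M) (hp : IsProper ℓ) :
    (∀ q ∈ simplex Y, expLoss ℓ q q = genEnt ℓ q) ∧
    (∀ q ∈ simplex Y, ∀ p ∈ simplex Y, expLoss ℓ p q ≥ genEnt ℓ p) ∧
    (∀ p ∈ simplex Y, ∀ q ∈ simplex Y,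
        genEnt ℓ p ≤ genEnt ℓ q + ∑ y, ℓ y q * (p y - q y)) ∧
    (∀ y : Y, ∀ q ∈ simplex Y,
        ℓ y q = genEnt ℓ q + ℓ y q - ∑ y', ℓ y' q * q y') := by
  refine ⟨fun q hq => hp.expLoss_self_eq_genEnt hq,
    fun q hq p hpm => hp.genEnt_le_expLoss hpm hq, fun p hpm q hq => ?_, fun y q hq => ?_⟩
  · have h := hp.genEnt_le_expLoss hpm hq
    have hself := hp.expLoss_self_eq_genEnt hq
    simp only [mul_sub, Finset.sum_sub_distrib, sum_loss_mul_eq_expLoss]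
    linarith
  · rw [sum_loss_mul_eq_expLoss, hp.expLoss_self_eq_genEnt hq]
    ring

end
end

section
/- (Calibration–refinement decomposition.) Let ℓ be a bounded scoring loss, P a PMF on X × Y, and h : X → Δ^Y a predictor. Then the risk decomposes as R_P(h,ℓ) = CE_P(h,ℓ) + RF_P(h,ℓ). -/
open Finset
open scoped Classical

noncomputable section

variable {X Y : Type*}

/-- Multiplying the conditional outcome distribution by the weight recovers the joint mass,
also where the weight vanishes. -/
theorem weight_mul_condOut [Fintype X] [Fintype Y] {P : X × Y → ℝ} (hP : ∀ z, 0 ≤ P z)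
    (h : X → Y → ℝ) (ν : Y → ℝ) (y : Y) :
    weight P h ν * condOut P h ν y = ∑ x ∈ univ.filter (fun x => h x = ν), P (x, y) := by
  by_cases hw : weight P h ν = 0
  · rw [hw, zero_mul, eq_comm]
    refine sum_eq_zero fun x hx => ?_
    have hx0 : margX P x = 0 :=
      (sum_eq_zero_iff_of_nonneg fun x _ => sum_nonneg fun y _ => hP (x, y)).1 hw x hx
    exact (sum_eq_zero_iff_of_nonneg fun y _ => hP (x, y)).1 hx0 y (mem_univ y)
  · exact mul_div_cancel₀ _ hw

theorem weight_mul_expLoss_condOut [Fintype X] [Fintype Y] {P : X × Y → ℝ} (hP : ∀ z, 0 ≤ P z)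
    (h : X → Y → ℝ) (ℓ : Y → (Y → ℝ) → ℝ) (ν : Y → ℝ) :
    weight P h ν * expLoss ℓ (condOut P h ν) ν =
      ∑ x ∈ univ.filter (fun x => h x = ν), ∑ y, P (x, y) * ℓ y (h x) := by
  rw [expLoss, mul_sum, sum_comm]
  refine sum_congr rfl fun y _ => ?_
  rw [← mul_assoc, weight_mul_condOut hP, sum_mul]
  exact sum_congr rfl fun x hx => by rw [(mem_filter.1 hx).2]

/-- calibration–refinement decomposition:
`R_P(h,ℓ) = CE_P(h,ℓ) + RF_P(h,ℓ)`. -/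
theorem calibration_refinement_decomposition
    [Fintype X] [Fintype Y] [Nonempty X] [Nonempty Y]
    (ℓ : Y → (Y → ℝ) → ℝ) (M : ℝ) (hb : IsBoundedLoss ℓ M)
    (P : X × Y → ℝ) (hP : IsPMF P)
    (h : X → Y → ℝ) (hh : ∀ x, h x ∈ simplex Y) :
    risk P h ℓ = CE P h ℓ + RF P h ℓ := by
  have hw (ν : Y → ℝ) : 0 ≤ weight P h ν :=
    sum_nonneg fun x _ => sum_nonneg fun y _ => hP.1 (x, y)
  calc risk P h ℓ = ∑ x, ∑ y, P (x, y) * ℓ y (h x) := Fintype.sum_prod_type _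
    _ = ∑ ν ∈ univ.image h, weight P h ν * expLoss ℓ (condOut P h ν) ν := by
      simp_rw [weight_mul_expLoss_condOut hP.1]
      exact (sum_fiberwise_of_maps_to (fun x _ => mem_image_of_mem h (mem_univ x)) _).symm
    _ = ∑ ν ∈ (univ.image h).filter (fun ν => 0 < weight P h ν),
          weight P h ν * expLoss ℓ (condOut P h ν) ν :=
      (sum_filter_of_ne fun ν _ hν => (hw ν).lt_of_ne' (left_ne_zero_of_mul hν)).symm
    _ = CE P h ℓ + RF P h ℓ := by
      rw [CE, RF, ← sum_add_distrib]
      exact sum_congr rfl fun ν _ => by rw [breg]; ring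

end
end

section
/- (Calibration and decision-making.) Let A be a nonempty finite action space, c : A × Y → ℝ a cost function, P a PMF on X × Y, and h : X → Δ^Y a predictor that is canonically calibrated under P. Let δ : Δ^Y → A satisfy δ(ν) ∈ argmin_{a ∈ A} Σ_y ν(y)·c(a,y) for every ν ∈ Δ^Y. Then for every decision rule δ' : Δ^Y → A, Σ_{x,y} P(x,y)·c(δ(h(x)), y) ≤ Σ_{x,y} P(x,y)·c(δ'(h(x)), y); i.e., the expected-cost-minimizing rule based on the calibrated predictor is optimal on average for every cost function. -/
open Finset
open scoped Classical

noncomputable section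

variable {X Y : Type*}

/-- Under a calibrated predictor, the joint mass of `h = ν` and outcome `y` is `w_ν · ν(y)`. -/
theorem Calibrated.sum_fiber_eq [Fintype X] [Fintype Y] {P : X × Y → ℝ} {h : X → Y → ℝ}
    (hcal : Calibrated P h) (hP : ∀ z, 0 ≤ P z) (ν : Y → ℝ) (y : Y) :
    ∑ x ∈ univ.filter (fun x => h x = ν), P (x, y) = weight P h ν * ν y := by
  have hmarg : ∀ x, 0 ≤ margX P x := fun x => sum_nonneg fun y _ => hP (x, y)
  have hw : 0 ≤ weight P h ν := sum_nonneg fun x _ => hmarg x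
  rcases hw.eq_or_lt with hw | hw
  · rw [← hw, zero_mul]
    refine sum_eq_zero fun x hx => ?_
    have hx0 : margX P x = 0 := (sum_eq_zero_iff_of_nonneg fun x _ => hmarg x).1 hw.symm x hx
    exact (sum_eq_zero_iff_of_nonneg fun y _ => hP (x, y)).1 hx0 y (mem_univ y)
  · have hy := congrFun (hcal ν hw) y
    rw [condOut, div_eq_iff hw.ne'] at hy
    rw [hy, mul_comm]

/-- Under a calibrated predictor, the expected cost of a decision rule is the `w_ν`-weighted sum
of its expected costs under the predictions `ν`. -/
theorem Calibrated.sum_cost_eq [Fintype X] [Fintype Y] {P : X × Y → ℝ} {h : X → Y → ℝ}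
    (hcal : Calibrated P h) (hP : ∀ z, 0 ≤ P z) {A : Type*} (c : A → Y → ℝ)
    (δ : (Y → ℝ) → A) :
    ∑ z : X × Y, P z * c (δ (h z.1)) z.2 =
      ∑ ν ∈ univ.image h, weight P h ν * ∑ y, ν y * c (δ ν) y := by
  rw [Fintype.sum_prod_type,
    ← sum_fiberwise_of_maps_to (s := univ) (t := univ.image h) (g := h)
      fun x hx => mem_image_of_mem h hx]
  refine sum_congr rfl fun ν _ => ?_
  rw [sum_comm, mul_sum]
  refine sum_congr rfl fun y _ => ?_
  rw [← mul_assoc, ← hcal.sum_fiber_eq hP ν y, sum_mul]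
  refine sum_congr rfl fun x hx => ?_
  rw [(mem_filter.1 hx).2]

/-- calibration and decision-making: the expected-cost-minimizing
decision rule based on a canonically calibrated predictor is optimal on average for
every cost function. -/
theorem calibrated_decision_optimal
    [Fintype X] [Fintype Y] [Nonempty X] [Nonempty Y]
    {A : Type*} [Fintype A] [Nonempty A]
    (c : A → Y → ℝ) (P : X × Y → ℝ) (hP : IsPMF P)
    (h : X → Y → ℝ) (hh : ∀ x, h x ∈ simplex Y) (hcal : Calibrated P h)
    (δ : (Y → ℝ) → A)
    (hδ : ∀ ν ∈ simplex Y, ∀ a : A, ∑ y, ν y * c (δ ν) y ≤ ∑ y, ν y * c a y) :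
    ∀ δ' : (Y → ℝ) → A,
      ∑ z : X × Y, P z * c (δ (h z.1)) z.2 ≤
        ∑ z : X × Y, P z * c (δ' (h z.1)) z.2 := by
  intro δ'
  rw [hcal.sum_cost_eq hP.1, hcal.sum_cost_eq hP.1]
  refine sum_le_sum fun ν hν => ?_
  obtain ⟨x, -, rfl⟩ := mem_image.1 hν
  exact mul_le_mul_of_nonneg_left (hδ _ (hh x) _)
    (sum_nonneg fun x _ => sum_nonneg fun y _ => hP.1 (x, y))

end
end

section
/- (Calibration and worst-case decision-making in MDL.) Let A be a nonempty finite action space, c : A × Y → ℝ a cost function, 𝒬 a nonempty set of PMFs on X × Y, Q* ∈ 𝒬, and h : X → Δ^Y a predictor that is canonically calibrated under Q*. Let δ : Δ^Y → A satisfy δ(ν) ∈ argmin_{a ∈ A} Σ_y ν(y)·c(a,y) for every ν ∈ Δ^Y, and for a decision rule δ' : Δ^Y → A write E_Q[c; δ', h] := Σ_{x,y} Q(x,y)·c(δ'(h(x)), y). Assume the consistency condition that Q* maximizes the minimal decision cost over 𝒬: for every Q ∈ 𝒬, inf_{δ' : Δ^Y → A} E_Q[c; δ', h] ≤ inf_{δ'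 : Δ^Y → A} E_{Q*}[c; δ', h]. Then E_{Q*}[c; δ, h] = sup_{Q ∈ 𝒬} inf_{δ' : Δ^Y → A} E_Q[c; δ', h]; i.e., the rule δ attains the worst-case optimal decision value over 𝒬. -/
open Finset
open scoped Classical

noncomputable section

variable {X Y : Type*}

/-- For a calibrated predictor, the joint mass of a level set of `h` and an outcome factors
through the weight of the level set, even when this weight vanishes. -/
theorem Calibrated.sum_filter_eq [Fintype X] [Fintype Y] {P : X × Y → ℝ} {h : X → Y → ℝ}
    (hP : IsPMF P) (hcal : Calibrated P h) (ν : Y → ℝ) (y : Y) :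
    ∑ x ∈ univ.filter (fun x => h x = ν), P (x, y) = weight P h ν * ν y := by
  have hmarg : ∀ x, 0 ≤ margX P x := fun x => sum_nonneg fun y _ => hP.1 (x, y)
  have hw : 0 ≤ weight P h ν := sum_nonneg fun x _ => hmarg x
  rcases hw.lt_or_eq with hpos | hzero
  · rw [← congrFun (hcal ν hpos) y, condOut, mul_div_cancel₀ _ hpos.ne']
  · rw [← hzero, zero_mul]
    refine sum_eq_zero fun x hx => ?_
    have hx0 : margX P x = 0 :=
      (sum_eq_zero_iff_of_nonneg fun x _ => hmarg x).1 hzero.symm x hx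
    exact (sum_eq_zero_iff_of_nonneg fun y _ => hP.1 (x, y)).1 hx0 y (mem_univ y)

/-- Under a calibrated predictor, the expected cost of a decision rule is the weighted sum of
its expected costs under the predicted distributions. -/
theorem Calibrated.expected_cost_eq [Fintype X] [Fintype Y] {A : Type*} {P : X × Y → ℝ}
    {h : X → Y → ℝ} (hP : IsPMF P) (hcal : Calibrated P h) (c : A → Y → ℝ)
    (d : (Y → ℝ) → A) :
    ∑ z : X × Y, P z * c (d (h z.1)) z.2 =
      ∑ ν ∈ univ.image h, weight P h ν * ∑ y, ν y * c (d ν) y := by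
  rw [Fintype.sum_prod_type,
    ← sum_fiberwise_of_maps_to (fun x _ => mem_image_of_mem h (mem_univ x))]
  refine sum_congr rfl fun ν _ => ?_
  rw [sum_comm, mul_sum]
  refine sum_congr rfl fun y _ => ?_
  rw [← mul_assoc, ← hcal.sum_filter_eq hP, sum_mul]
  refine sum_congr rfl fun x hx => ?_
  rw [(mem_filter.1 hx).2]

/-- calibration and worst-case decision-making in MDL: if `h` is
calibrated under `Q*` and `Q*` maximizes the minimal decision cost over `𝒬`, then the
expected-cost-minimizing rule `δ` attains the worst-case optimal decision value. -/
theorem mdl_worst_case_decision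
    [Fintype X] [Fintype Y] [Nonempty X] [Nonempty Y]
    {A : Type*} [Fintype A] [Nonempty A]
    (c : A → Y → ℝ)
    (𝒬 : Set (X × Y → ℝ)) (h𝒬 : ∀ Q ∈ 𝒬, IsPMF Q) (hne : 𝒬.Nonempty)
    (Qs : X × Y → ℝ) (hQs : Qs ∈ 𝒬)
    (h : X → Y → ℝ) (hh : ∀ x, h x ∈ simplex Y) (hcal : Calibrated Qs h)
    (δ : (Y → ℝ) → A)
    (hδ : ∀ ν ∈ simplex Y, ∀ a : A, ∑ y, ν y * c (δ ν) y ≤ ∑ y, ν y * c a y)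
    (hcons : ∀ Q ∈ 𝒬,
      sInf {v : ℝ | ∃ δ' : (Y → ℝ) → A,
          v = ∑ z : X × Y, Q z * c (δ' (h z.1)) z.2} ≤
        sInf {v : ℝ | ∃ δ' : (Y → ℝ) → A,
          v = ∑ z : X × Y, Qs z * c (δ' (h z.1)) z.2}) :
    ∑ z : X × Y, Qs z * c (δ (h z.1)) z.2 =
      sSup {v : ℝ | ∃ Q ∈ 𝒬,
        v = sInf {w : ℝ | ∃ δ' : (Y → ℝ) → A,
          w = ∑ z : X × Y, Q z * c (δ' (h z.1)) z.2}} := by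
  have hP := h𝒬 Qs hQs
  have hleast : IsLeast {v : ℝ | ∃ δ' : (Y → ℝ) → A,
      v = ∑ z : X × Y, Qs z * c (δ' (h z.1)) z.2}
      (∑ z : X × Y, Qs z * c (δ (h z.1)) z.2) := by
    refine ⟨⟨δ, rfl⟩, ?_⟩
    rintro _ ⟨δ', rfl⟩
    rw [hcal.expected_cost_eq hP, hcal.expected_cost_eq hP]
    refine sum_le_sum fun ν hν => mul_le_mul_of_nonneg_left ?_
      (sum_nonneg fun x _ => sum_nonneg fun y _ => hP.1 (x, y))
    obtain ⟨x, -, rfl⟩ := mem_image.1 hν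
    exact hδ (h x) (hh x) (δ' (h x))
  have hgreatest : IsGreatest {v : ℝ | ∃ Q ∈ 𝒬,
      v = sInf {w : ℝ | ∃ δ' : (Y → ℝ) → A,
        w = ∑ z : X × Y, Q z * c (δ' (h z.1)) z.2}}
      (∑ z : X × Y, Qs z * c (δ (h z.1)) z.2) := by
    refine ⟨⟨Qs, hQs, hleast.csInf_eq.symm⟩, ?_⟩
    rintro _ ⟨Q, hQ, rfl⟩
    exact (hcons Q hQ).trans_eq hleast.csInf_eq
  exact hgreatest.csSup_eq.symm

end
end

section
/- (Robust and equitable DRO via entropy-Lipschitz divergences.) Let ℓ be a bounded proper scoring loss, d a nonnegative real-valued function on pairs of PMFs on X × Y, and κ ≥ 0 such that the Lipschitz condition |B_P(ℓ) − B_Q(ℓ)| ≤ κ·d(P,Q) holds for all PMFs P, Q on X × Y. Fix a PMF P̂ and ε > 0, and let 𝒬 := {Q : d(P̂,Q) ≤ ε}. Let Q* ∈ 𝒬 with Q*_X(x) > 0 for all x ∈ X, set h*(x) := Q*(·|x), and assume R_Q(h*,ℓ) ≤ R_{Q*}(h*,ℓ) for every Q ∈ 𝒬. Then the calibration error is uniformly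 small over the ambiguity set: CE_Q(h*,ℓ) ≤ 2κε for every Q ∈ 𝒬. -/
open Finset
open scoped Classical

noncomputable section

variable {X Y : Type*}

theorem genEnt_eq_expLoss_self [Fintype Y] {ℓ : Y → (Y → ℝ) → ℝ} (hp : IsProper ℓ)
    {p : Y → ℝ} (h : p ∈ simplex Y) : genEnt ℓ p = expLoss ℓ p p :=
  IsLeast.csInf_eq ⟨⟨p, h, rfl⟩, by rintro _ ⟨q, hq, rfl⟩; exact hp p h q hq⟩

theorem div_sum_mem_simplex [Fintype Y] {f : Y → ℝ} (hf : ∀ y, 0 ≤ f y) (h : 0 < ∑ y, f y) :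
    (fun y => f y / ∑ y, f y) ∈ simplex Y :=
  ⟨fun y => div_nonneg (hf y) h.le, by rw [← Finset.sum_div, div_self h.ne']⟩

theorem mul_expLoss_div [Fintype Y] (ℓ : Y → (Y → ℝ) → ℝ) (f q : Y → ℝ) {c : ℝ} (hc : c ≠ 0) :
    c * expLoss ℓ (fun y => f y / c) q = ∑ y, f y * ℓ y q := by
  rw [expLoss, Finset.mul_sum]
  refine Finset.sum_congr rfl fun y _ => ?_
  field_simp

theorem margX_nonneg [Fintype Y] {Q : X × Y → ℝ} (hQ : ∀ z, 0 ≤ Q z) (x : X) : 0 ≤ margX Q x :=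
  Finset.sum_nonneg fun _ _ => hQ _

theorem eq_zero_of_margX_eq_zero [Fintype Y] {Q : X × Y → ℝ} (hQ : ∀ z, 0 ≤ Q z) {x : X}
    (h : margX Q x = 0) (y : Y) : Q (x, y) = 0 :=
  (Finset.sum_eq_zero_iff_of_nonneg fun _ _ => hQ _).1 h y (Finset.mem_univ y)

theorem condY_mem_simplex [Fintype Y] {Q : X × Y → ℝ} (hQ : ∀ z, 0 ≤ Q z) {x : X}
    (h : 0 < margX Q x) : condY Q x ∈ simplex Y :=
  div_sum_mem_simplex (fun _ => hQ _) h

theorem weight_eq_sum [Fintype X] [Fintype Y] (Q : X × Y → ℝ) (h : X → Y → ℝ) (ν : Y → ℝ) :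
    weight Q h ν = ∑ y, ∑ x ∈ univ.filter (fun x => h x = ν), Q (x, y) :=
  Finset.sum_comm

theorem condOut_mem_simplex [Fintype X] [Fintype Y] {Q : X × Y → ℝ} (hQ : ∀ z, 0 ≤ Q z)
    {h : X → Y → ℝ} {ν : Y → ℝ} (hν : 0 < weight Q h ν) : condOut Q h ν ∈ simplex Y := by
  rw [weight_eq_sum] at hν
  unfold condOut
  rw [weight_eq_sum]
  exact div_sum_mem_simplex (fun _ => Finset.sum_nonneg fun _ _ => hQ _) hν

/-- The risk of `g` as a sum, over the support of the `X`-marginal, of conditional losses. -/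
theorem risk_eq_sum_margX [Fintype X] [Fintype Y] {Q : X × Y → ℝ} (hQ : ∀ z, 0 ≤ Q z)
    (g : X → Y → ℝ) (ℓ : Y → (Y → ℝ) → ℝ) :
    risk Q g ℓ = ∑ x ∈ univ.filter (fun x => 0 < margX Q x),
      margX Q x * expLoss ℓ (condY Q x) (g x) := by
  rw [risk, Fintype.sum_prod_type, Finset.sum_filter]
  refine Finset.sum_congr rfl fun x _ => ?_
  split_ifs with hx
  · exact (mul_expLoss_div ℓ (fun y => Q (x, y)) (g x) hx.ne').symm
  · have h0 := le_antisymm (not_lt.1 hx) (margX_nonneg hQ x)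
    exact Finset.sum_eq_zero fun y _ => by
      rw [eq_zero_of_margX_eq_zero hQ h0, zero_mul]

/-- The risk of a post-processing `φ ∘ h` as a sum over the level sets of `h`. -/
theorem risk_comp_eq_sum_weight [Fintype X] [Fintype Y] {Q : X × Y → ℝ} (hQ : ∀ z, 0 ≤ Q z)
    (h : X → Y → ℝ) (φ : (Y → ℝ) → Y → ℝ) (ℓ : Y → (Y → ℝ) → ℝ) :
    risk Q (fun x => φ (h x)) ℓ = ∑ ν ∈ (univ.image h).filter (fun ν => 0 < weight Q h ν),
      weight Q h ν * expLoss ℓ (condOut Q h ν) (φ ν) := by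
  rw [risk, Fintype.sum_prod_type, Finset.sum_filter,
    ← Finset.sum_fiberwise_of_maps_to (t := univ.image h) (g := h)
      (fun x hx => Finset.mem_image_of_mem h hx)]
  refine Finset.sum_congr rfl fun ν _ => ?_
  have hfib : ∑ x ∈ univ.filter (fun x => h x = ν), ∑ y, Q (x, y) * ℓ y (φ (h x)) =
      ∑ x ∈ univ.filter (fun x => h x = ν), ∑ y, Q (x, y) * ℓ y (φ ν) :=
    Finset.sum_congr rfl fun x hx => by rw [(Finset.mem_filter.1 hx).2]
  rw [hfib]
  split_ifs with hν
  · unfold condOut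
    rw [mul_expLoss_div ℓ _ _ hν.ne', Finset.sum_comm]
    simp only [Finset.sum_mul]
  · have hmarg : ∀ x ∈ univ.filter (fun x => h x = ν), 0 ≤ margX Q x :=
      fun x _ => margX_nonneg hQ x
    have h0 : weight Q h ν = 0 := le_antisymm (not_lt.1 hν) (Finset.sum_nonneg hmarg)
    refine Finset.sum_eq_zero fun x hx => Finset.sum_eq_zero fun y _ => ?_
    rw [eq_zero_of_margX_eq_zero hQ ((Finset.sum_eq_zero_iff_of_nonneg hmarg).1 h0 x hx), zero_mul]

theorem BayesRF_le_risk [Fintype X] [Fintype Y] {ℓ : Y → (Y → ℝ) → ℝ} (hp : IsProper ℓ)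
    {Q : X × Y → ℝ} (hQ : ∀ z, 0 ≤ Q z) {g : X → Y → ℝ} (hg : ∀ x, g x ∈ simplex Y) :
    BayesRF Q ℓ ≤ risk Q g ℓ := by
  rw [risk_eq_sum_margX hQ]
  refine Finset.sum_le_sum fun x hx => ?_
  have hx := (Finset.mem_filter.1 hx).2
  have hc := condY_mem_simplex hQ hx
  rw [genEnt_eq_expLoss_self hp hc]
  exact mul_le_mul_of_nonneg_left (hp _ hc _ (hg x)) hx.le

theorem risk_condY_eq_BayesRF [Fintype X] [Fintype Y] {ℓ : Y → (Y → ℝ) → ℝ} (hp : IsProper ℓ)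
    {Q : X × Y → ℝ} (hQ : ∀ z, 0 ≤ Q z) : risk Q (condY Q) ℓ = BayesRF Q ℓ := by
  rw [risk_eq_sum_margX hQ]
  refine Finset.sum_congr rfl fun x hx => ?_
  rw [genEnt_eq_expLoss_self hp (condY_mem_simplex hQ (Finset.mem_filter.1 hx).2)]

theorem CE_add_RF [Fintype X] [Fintype Y] {Q : X × Y → ℝ} (hQ : ∀ z, 0 ≤ Q z)
    (h : X → Y → ℝ) (ℓ : Y → (Y → ℝ) → ℝ) : CE Q h ℓ + RF Q h ℓ = risk Q h ℓ := by
  rw [risk_comp_eq_sum_weight hQ h (fun ν => ν), CE, RF, ← Finset.sum_add_distrib]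
  refine Finset.sum_congr rfl fun ν _ => ?_
  rw [breg]
  ring

/-- Refinement is the risk of the recalibrated predictor, hence at least the Bayes refinement. -/
theorem BayesRF_le_RF [Fintype X] [Fintype Y] {ℓ : Y → (Y → ℝ) → ℝ} (hp : IsProper ℓ)
    {Q : X × Y → ℝ} (hQ : ∀ z, 0 ≤ Q z) {h : X → Y → ℝ} (hh : ∀ x, h x ∈ simplex Y) :
    BayesRF Q ℓ ≤ RF Q h ℓ := by
  let φ : (Y → ℝ) → Y → ℝ := fun ν => if 0 < weight Q h ν then condOut Q h ν else ν
  have hφ : ∀ x, φ (h x) ∈ simplex Y := fun x => by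
    simp only [φ]
    split_ifs with hν
    exacts [condOut_mem_simplex hQ hν, hh x]
  refine (BayesRF_le_risk hp hQ hφ).trans_eq ?_
  rw [risk_comp_eq_sum_weight hQ h φ]
  refine Finset.sum_congr rfl fun ν hν => ?_
  have hν := (Finset.mem_filter.1 hν).2
  rw [genEnt_eq_expLoss_self hp (condOut_mem_simplex hQ hν)]
  simp only [φ, if_pos hν]

/-- robust and equitable DRO: if the divergence defining the ambiguity
set is `κ`-Lipschitz with respect to the expected generalized entropy, the calibration
error of the MDL-optimal predictor is uniformly at most `2κε` over the set. -/
theorem dro_uniform_calibration_bound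
    [Fintype X] [Fintype Y] [Nonempty X] [Nonempty Y]
    (ℓ : Y → (Y → ℝ) → ℝ) (M : ℝ) (hb : IsBoundedLoss ℓ M) (hp : IsProper ℓ)
    (d : (X × Y → ℝ) → (X × Y → ℝ) → ℝ)
    (hd : ∀ P Q : X × Y → ℝ, IsPMF P → IsPMF Q → 0 ≤ d P Q)
    (κ : ℝ) (hκ : 0 ≤ κ)
    (hLip : ∀ P Q : X × Y → ℝ, IsPMF P → IsPMF Q →
      |BayesRF P ℓ - BayesRF Q ℓ| ≤ κ * d P Q)
    (Phat : X × Y → ℝ) (hPhat : IsPMF Phat) (ε : ℝ) (hε : 0 < ε)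
    (Qs : X × Y → ℝ) (hQsPMF : IsPMF Qs) (hQsMem : d Phat Qs ≤ ε)
    (hpos : ∀ x, 0 < margX Qs x)
    (hsaddle : ∀ Q : X × Y → ℝ, IsPMF Q → d Phat Q ≤ ε →
      risk Q (fun x => condY Qs x) ℓ ≤ risk Qs (fun x => condY Qs x) ℓ) :
    ∀ Q : X × Y → ℝ, IsPMF Q → d Phat Q ≤ ε →
      CE Q (fun x => condY Qs x) ℓ ≤ 2 * κ * ε := by
  intro Q hQ hQmem
  have hrisk := hsaddle Q hQ hQmem
  rw [← CE_add_RF hQ.1] at hrisk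
  have hBayes : risk Qs (fun x => condY Qs x) ℓ = BayesRF Qs ℓ :=
    risk_condY_eq_BayesRF hp hQsPMF.1
  have hRF : BayesRF Q ℓ ≤ RF Q (fun x => condY Qs x) ℓ :=
    BayesRF_le_RF hp hQ.1 fun x => condY_mem_simplex hQsPMF.1 (hpos x)
  have hLipQ := (le_abs_self _).trans (hLip Phat Q hPhat hQ)
  have hLipQs := (neg_le_abs _).trans (hLip Phat Qs hPhat hQsPMF)
  have hdQ := mul_le_mul_of_nonneg_left hQmem hκ
  have hdQs := mul_le_mul_of_nonneg_left hQsMem hκ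
  linarith

end
end
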